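/- Let d ≥ 1, let B ⊆ ℝ^d be open, and let X : B × ℝ → ℝ^d and u : ℝ^d × ℝ → ℝ^d be twice continuously differentiable maps such that ∂X/∂t(s,t) = u(X(s,t), t), and assume the deformation gradient F(s,t) := D_s X(s,t) is invertible for all (s,t). Set J(s,t) := det F(s,t). Then for every (s,t) ∈ B × ℝ, the divergence of the velocity field evaluated along the motion satisfies (div_x u)(X(s,t), t) = (∂J/∂t)(s,t) / J(s,t), where div_x u = trace(D_x u) is the spatial divergence of u(·,t). -/

import Mathlib

open Set

theorem aux_det_matrix {n : ℕ} (H : ℝ → Matrix (Fin n) (Fin n) ℝ) (L : Matrix (Fin n) (Fin n) ℝ)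
    (t : ℝ) (h1 : H t = 1) (hH : ∀ i j, HasDerivAt (fun τ => H τ i j) (L i j) t) :
    HasDerivAt (fun τ => (H τ).det) L.trace t := by
  let D : ContinuousMultilinearMap ℝ (fun _ : Fin n => (Fin n → ℝ)) ℝ :=
    { (Matrix.detRowAlternating (n := Fin n) (R := ℝ)).toMultilinearMap with
      cont := by
        show Continuous (fun M : Matrix (Fin n) (Fin n) ℝ => M.det)
        exact continuous_id.matrix_det }
  have hD : ∀ M : Matrix (Fin n) (Fin n) ℝ, D M = M.det := fun M => rfl
  have hd : HasDerivAt (fun τ => (fun i j => H τ i j : Fin n → Fin n → ℝ))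
      (fun i j => L i j) t := by
    rw [hasDerivAt_pi]; intro i
    rw [hasDerivAt_pi]; intro j
    exact hH i j
  have := (D.hasFDerivAt (x := (fun i j => H t i j))).comp_hasDerivAt t hd
  refine HasDerivAt.congr_deriv this ?_
  rw [ContinuousMultilinearMap.linearDeriv_apply, Matrix.trace]
  refine Finset.sum_congr rfl fun i _ => ?_
  have h2 : (fun i j => H t i j) = (1 : Matrix (Fin n) (Fin n) ℝ) := by rw [← h1]
  rw [h2]
  change (Matrix.updateRow (1 : Matrix (Fin n) (Fin n) ℝ) i (L i)).det = _
  rw [← Matrix.cramer_transpose_apply]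
  simp

theorem aux_det {n : ℕ} {E : Type*} [NormedAddCommGroup E] [NormedSpace ℝ E]
    [FiniteDimensional ℝ E] (b : Module.Basis (Fin n) ℝ E) (F : ℝ → E →L[ℝ] E) (L : E →L[ℝ] E)
    (t : ℝ) (hu : IsUnit (F t).toLinearMap) (hF : HasDerivAt F (L.comp (F t)) t) :
    HasDerivAt (fun τ => LinearMap.det (F τ).toLinearMap)
      (LinearMap.trace ℝ E L.toLinearMap * LinearMap.det (F t).toLinearMap) t := by
  obtain ⟨g, hg⟩ := hu.exists_right_inv
  have hg' : ∀ v, F t (g v) = v := fun v => by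
    simpa using congrArg (fun f => f v) hg
  have hd : LinearMap.det g * LinearMap.det (F t).toLinearMap = 1 := by
    rw [mul_comm, ← map_mul, hg, map_one]
  have key := aux_det_matrix (fun τ => LinearMap.toMatrix b b ((F τ).toLinearMap * g))
    (LinearMap.toMatrix b b L.toLinearMap) t (by simp [hg]) (by
      intro i j
      simp only [LinearMap.toMatrix_apply]
      have h1 : HasDerivAt (fun τ => F τ (g (b j))) (L (b j)) t := by
        have := hF.clm_apply (hasDerivAt_const t (g (b j)))
        simpa [hg'] using this
      have h2 := (LinearMap.toContinuousLinearMap (b.coord i)).hasFDerivAt.comp_hasDerivAt t h1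
      exact h2)
  rw [← LinearMap.trace_eq_matrix_trace ℝ b] at key
  have k2 := key.mul_const (LinearMap.det (F t).toLinearMap)
  refine k2.congr_of_eventuallyEq (Filter.Eventually.of_forall fun τ => ?_)
  simp only [LinearMap.det_toMatrix, map_mul]
  rw [mul_assoc, hd, mul_one]


open Set

/-- If `X(s,t)` is a C² motion on an open set `B` driven by the C² Eulerian velocity
field `u` (i.e. `∂X/∂t(s,t) = u(X(s,t),t)`), and the deformation gradient
`F(s,t) = D_s X(s,t)` is invertible everywhere, then with `J(s,t) := det F(s,t)`
the spatial divergence of `u` along the motion satisfies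
`(div_x u)(X(s,t),t) = (∂J/∂t)(s,t) / J(s,t)`. -/
theorem divergence_eq_Jdot_over_J
    (d : ℕ) (hd : 1 ≤ d) (B : Set (EuclideanSpace ℝ (Fin d))) (hB : IsOpen B)
    (X : EuclideanSpace ℝ (Fin d) → ℝ → EuclideanSpace ℝ (Fin d))
    (u : EuclideanSpace ℝ (Fin d) → ℝ → EuclideanSpace ℝ (Fin d))
    (hX : ContDiffOn ℝ 2
      (fun p : EuclideanSpace ℝ (Fin d) × ℝ => X p.1 p.2) (B ×ˢ (univ : Set ℝ)))
    (hu : ContDiff ℝ 2 (fun p : EuclideanSpace ℝ (Fin d) × ℝ => u p.1 p.2))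
    (hode : ∀ s ∈ B, ∀ t : ℝ, HasDerivAt (fun τ => X s τ) (u (X s t) t) t)
    (hinv : ∀ s ∈ B, ∀ t : ℝ, IsUnit (fderiv ℝ (fun s' => X s' t) s).toLinearMap) :
    ∀ s ∈ B, ∀ t : ℝ,
      LinearMap.trace ℝ (EuclideanSpace ℝ (Fin d))
          (fderiv ℝ (fun x => u x t) (X s t)).toLinearMap
        = deriv (fun τ => LinearMap.det (fderiv ℝ (fun s' => X s' τ) s).toLinearMap) t /
            LinearMap.det (fderiv ℝ (fun s' => X s' t) s).toLinearMap := by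
  intro s hs t
  let G : EuclideanSpace ℝ (Fin d) × ℝ → EuclideanSpace ℝ (Fin d) := fun p => X p.1 p.2
  have hopen : IsOpen (B ×ˢ (univ : Set ℝ)) := hB.prod isOpen_univ
  have hG : ∀ s ∈ B, ∀ t, ContDiffAt ℝ 2 G (s, t) := fun s hs t =>
    hX.contDiffAt (hopen.mem_nhds ⟨hs, mem_univ _⟩)
  have hGd : ∀ s ∈ B, ∀ t, HasFDerivAt G (fderiv ℝ G (s, t)) (s, t) := fun s hs t =>
    ((hG s hs t).differentiableAt (by norm_num)).hasFDerivAt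
  have hFs : ∀ s ∈ B, ∀ t, HasFDerivAt (fun s' => X s' t)
      ((fderiv ℝ G (s, t)).comp (ContinuousLinearMap.inl ℝ _ ℝ)) s := fun s hs t =>
    HasFDerivAt.comp (g := G) (f := fun s' => (s', t)) s (hGd s hs t)
      (hasFDerivAt_prodMk_left s t)
  have hGt : ∀ s ∈ B, ∀ t, fderiv ℝ G (s, t) (0, 1) = u (X s t) t := fun s hs t => by
    have h1 := (hGd s hs t).comp_hasDerivAt t ((hasDerivAt_const t s).prodMk (hasDerivAt_id t))
    exact h1.unique (hode s hs t)
  have hD2 : HasFDerivAt (fderiv ℝ G) (fderiv ℝ (fderiv ℝ G) (s, t)) (s, t) :=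
    (((hG s hs t).fderiv_right (m := 1) (by norm_num)).differentiableAt (by norm_num)).hasFDerivAt
  have hsymm : IsSymmSndFDerivAt ℝ G (s, t) := (hG s hs t).isSymmSndFDerivAt (by simp)
  set L := fderiv ℝ (fun x => u x t) (X s t) with hL
  have hLd : HasFDerivAt (fun x => u x t) L (X s t) := by
    have : Differentiable ℝ (fun x => u x t) :=
      (hu.differentiable (by norm_num)).comp (differentiable_id.prodMk (differentiable_const t))
    exact (this _).hasFDerivAt
  have hmix : ∀ v, fderiv ℝ (fderiv ℝ G) (s, t) (v, 0) (0, 1)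
      = L (fderiv ℝ (fun s' => X s' t) s v) := by
    intro v
    have h1 : HasFDerivAt (fun s' => fderiv ℝ G (s', t)) _ s :=
      hD2.comp s (hasFDerivAt_prodMk_left s t)
    have h2 := h1.clm_apply (hasFDerivAt_const ((0 : EuclideanSpace ℝ (Fin d)), (1 : ℝ)) s)
    have h3 := hLd.comp s (hFs s hs t)
    have h4 := h3.congr_of_eventuallyEq (f₁ := fun s' => fderiv ℝ G (s', t) (0, 1))
      (Filter.eventually_of_mem (hB.mem_nhds hs) fun s' hs' => hGt s' hs' t)
    have h5 := congrArg (fun f => f v) (h2.unique h4)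
    rw [(hFs s hs t).fderiv]
    simpa using h5
  have hF : HasDerivAt (fun τ => fderiv ℝ (fun s' => X s' τ) s)
      (L.comp (fderiv ℝ (fun s' => X s' t) s)) t := by
    have h1 : HasDerivAt (fun τ => fderiv ℝ G (s, τ)) _ t :=
      hD2.comp_hasDerivAt t ((hasDerivAt_const t s).prodMk (hasDerivAt_id t))
    have h2 := h1.clm_comp
      (hasDerivAt_const t (ContinuousLinearMap.inl ℝ (EuclideanSpace ℝ (Fin d)) ℝ))
    have h3 := h2.congr_of_eventuallyEq (f₁ := fun τ => fderiv ℝ (fun s' => X s' τ) s)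
      (Filter.Eventually.of_forall fun τ => (hFs s hs τ).fderiv)
    refine h3.congr_deriv ?_
    ext1 v
    have := hsymm.eq (0, 1) (v, 0)
    simp only [ContinuousLinearMap.comp_apply, ← hmix v, ← this]
    simp
  have hdet := aux_det (EuclideanSpace.basisFun (Fin d) ℝ).toBasis _ L t (hinv s hs t) hF
  rw [hdet.deriv, mul_div_assoc, div_self, mul_one]
  exact ((hinv s hs t).map LinearMap.det).ne_zero
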